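/- The function h_PB : ℝⁿ → ℝ is continuous on ℝⁿ, satisfies h_PB(x) ≥ 0 for all x ∈ ℝⁿ, and for every x ∈ ℝⁿ the infimum defining h_PB(x) is attained by some input sequence u ∈ U^N. -/

import Mathlib

/-- Closed-loop trajectory: `traj f x u 0 = x`, `traj f x u (i+1) = f (traj f x u i, u i)`. -/
noncomputable def traj {n m : ℕ}
    (f : EuclideanSpace ℝ (Fin n) × EuclideanSpace ℝ (Fin m) → EuclideanSpace ℝ (Fin n))
    (x : EuclideanSpace ℝ (Fin n)) (u : ℕ → EuclideanSpace ℝ (Fin m)) :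
    ℕ → EuclideanSpace ℝ (Fin n)
  | 0 => x
  | i + 1 => f (traj f x u i, u i)

/-- Soft-constrained PCBF cost of an input sequence `u`:
`α_f · max 0 (h_f x_N) + Σ_{i<N} ‖max 0 (c x_i + Δ_i 𝟙)‖` (componentwise max,
Euclidean norm). -/
noncomputable def pcbfCost {n m nc : ℕ} (N : ℕ)
    (f : EuclideanSpace ℝ (Fin n) × EuclideanSpace ℝ (Fin m) → EuclideanSpace ℝ (Fin n))
    (c : EuclideanSpace ℝ (Fin n) → EuclideanSpace ℝ (Fin nc)) (Δ : ℕ → ℝ)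
    (hf : EuclideanSpace ℝ (Fin n) → ℝ) (αf : ℝ)
    (x : EuclideanSpace ℝ (Fin n)) (u : ℕ → EuclideanSpace ℝ (Fin m)) : ℝ :=
  αf * max 0 (hf (traj f x u N)) +
    ∑ i ∈ Finset.range N,
      ‖((fun j => max 0 (c (traj f x u i) j + Δ i)) : Fin nc → ℝ)‖

/-- The PCBF `h_PB x`: infimum of `pcbfCost` over admissible input sequences. -/
noncomputable def hPB {n m nc : ℕ} (N : ℕ) (U : Set (EuclideanSpace ℝ (Fin m)))
    (f : EuclideanSpace ℝ (Fin n) × EuclideanSpace ℝ (Fin m) → EuclideanSpace ℝ (Fin n))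
    (c : EuclideanSpace ℝ (Fin n) → EuclideanSpace ℝ (Fin nc)) (Δ : ℕ → ℝ)
    (hf : EuclideanSpace ℝ (Fin n) → ℝ) (αf : ℝ) (x : EuclideanSpace ℝ (Fin n)) : ℝ :=
  sInf ((fun u => pcbfCost N f c Δ hf αf x u) '' {u | ∀ i < N, u i ∈ U})

/-- Cost of the extended value function: `max { max_{i<N, j} ([c x_i]_j + Δ_i), h_f x_N }`. -/
noncomputable def extCost {n m nc : ℕ} (N : ℕ)
    (f : EuclideanSpace ℝ (Fin n) × EuclideanSpace ℝ (Fin m) → EuclideanSpace ℝ (Fin n))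
    (c : EuclideanSpace ℝ (Fin n) → EuclideanSpace ℝ (Fin nc)) (Δ : ℕ → ℝ)
    (hf : EuclideanSpace ℝ (Fin n) → ℝ)
    (x : EuclideanSpace ℝ (Fin n)) (u : ℕ → EuclideanSpace ℝ (Fin m)) : ℝ :=
  max (⨆ q : Fin N × Fin nc, (c (traj f x u q.1) q.2 + Δ q.1)) (hf (traj f x u N))

/-- The extended value function `h̄_PB x` (slacks not sign-constrained). -/
noncomputable def hbarPB {n m nc : ℕ} (N : ℕ) (U : Set (EuclideanSpace ℝ (Fin m)))
    (f : EuclideanSpace ℝ (Fin n) × EuclideanSpace ℝ (Fin m) → EuclideanSpace ℝ (Fin n))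
    (c : EuclideanSpace ℝ (Fin n) → EuclideanSpace ℝ (Fin nc)) (Δ : ℕ → ℝ)
    (hf : EuclideanSpace ℝ (Fin n) → ℝ) (x : EuclideanSpace ℝ (Fin n)) : ℝ :=
  sInf ((fun u => extCost N f c Δ hf x u) '' {u | ∀ i < N, u i ∈ U})

theorem continuous_traj {n m : ℕ}
    {f : EuclideanSpace ℝ (Fin n) × EuclideanSpace ℝ (Fin m) → EuclideanSpace ℝ (Fin n)}
    (hfc : Continuous f) (i : ℕ) :
    Continuous fun p : EuclideanSpace ℝ (Fin n) × (ℕ → EuclideanSpace ℝ (Fin m)) =>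
      traj f p.1 p.2 i := by
  induction i with
  | zero => exact continuous_fst
  | succ i ih => exact hfc.comp (ih.prodMk ((continuous_apply i).comp continuous_snd))

theorem traj_congr {n m : ℕ}
    (f : EuclideanSpace ℝ (Fin n) × EuclideanSpace ℝ (Fin m) → EuclideanSpace ℝ (Fin n))
    (x : EuclideanSpace ℝ (Fin n)) {u v : ℕ → EuclideanSpace ℝ (Fin m)} {i : ℕ}
    (h : ∀ k < i, u k = v k) : traj f x u i = traj f x v i := by
  induction i with
  | zero => rfl
  | succ i ih =>
    simp only [traj]
    rw [ih fun k hk => h k (by omega), h i (by omega)]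

section

variable {n m nc : ℕ} (N : ℕ)
  {f : EuclideanSpace ℝ (Fin n) × EuclideanSpace ℝ (Fin m) → EuclideanSpace ℝ (Fin n)}
  {c : EuclideanSpace ℝ (Fin n) → EuclideanSpace ℝ (Fin nc)} (Δ : ℕ → ℝ)
  {hf : EuclideanSpace ℝ (Fin n) → ℝ} {αf : ℝ}

theorem continuous_pcbfCost (hfc : Continuous f) (hcc : Continuous c) (hfcont : Continuous hf) :
    Continuous fun p : EuclideanSpace ℝ (Fin n) × (ℕ → EuclideanSpace ℝ (Fin m)) =>
      pcbfCost N f c Δ hf αf p.1 p.2 := by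
  have ht := continuous_traj hfc
  unfold pcbfCost
  refine (continuous_const.mul (continuous_const.max (hfcont.comp (ht N)))).add
    (continuous_finsetSum _ fun i _ => (continuous_pi fun j => continuous_const.max
      (Continuous.add ?_ continuous_const)).norm)
  exact (EuclideanSpace.proj (𝕜 := ℝ) j).continuous.comp (hcc.comp (ht i))

theorem pcbfCost_nonneg (hαf : 0 ≤ αf) (x : EuclideanSpace ℝ (Fin n))
    (u : ℕ → EuclideanSpace ℝ (Fin m)) : 0 ≤ pcbfCost N f c Δ hf αf x u := by
  unfold pcbfCost
  positivity

theorem pcbfCost_congr (x : EuclideanSpace ℝ (Fin n)) {u v : ℕ → EuclideanSpace ℝ (Fin m)}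
    (h : ∀ k < N, u k = v k) :
    pcbfCost N f c Δ hf αf x u = pcbfCost N f c Δ hf αf x v := by
  unfold pcbfCost
  rw [traj_congr f x h]
  congr 1
  refine Finset.sum_congr rfl fun i hi => ?_
  rw [traj_congr f x fun k hk => h k (hk.trans (Finset.mem_range.1 hi))]

/-- Only the first `N` inputs enter the cost, so the infimum may be taken over the compact
set of sequences all of whose terms lie in `U`. -/
theorem hPB_eq_sInf_pi {U : Set (EuclideanSpace ℝ (Fin m))} (hUne : U.Nonempty)
    (x : EuclideanSpace ℝ (Fin n)) :
    hPB N U f c Δ hf αf x =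
      sInf ((fun u => pcbfCost N f c Δ hf αf x u) '' Set.univ.pi fun _ : ℕ => U) := by
  obtain ⟨u₀, hu₀⟩ := hUne
  unfold hPB
  congr 1
  ext y
  constructor
  · rintro ⟨u, hu, rfl⟩
    refine ⟨fun i => if i < N then u i else u₀, fun i _ => ?_, pcbfCost_congr N Δ x ?_⟩
    · by_cases hi : i < N
      · simpa [hi] using hu i hi
      · simpa [hi] using hu₀
    · intro k hk
      simp [hk]
  · rintro ⟨u, hu, rfl⟩
    exact ⟨u, fun i _ => hu i trivial, rfl⟩

end

/-- The PCBF `h_PB` is continuous on `ℝⁿ`, non-negative, and its infimum is attained. -/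
theorem stmt11
    {n m nc N : ℕ} (hN : 0 < N) (hnc : 0 < nc)
    (U : Set (EuclideanSpace ℝ (Fin m))) (hUcomp : IsCompact U) (hUne : U.Nonempty)
    (f : EuclideanSpace ℝ (Fin n) × EuclideanSpace ℝ (Fin m) → EuclideanSpace ℝ (Fin n))
    (hfc : Continuous f)
    (c : EuclideanSpace ℝ (Fin n) → EuclideanSpace ℝ (Fin nc)) (hcc : Continuous c)
    (Δ : ℕ → ℝ)
    (hf : EuclideanSpace ℝ (Fin n) → ℝ) (hfcont : Continuous hf)
    (αf : ℝ) (hαf : 0 < αf) :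
    Continuous (fun x => hPB N U f c Δ hf αf x) ∧
    (∀ x : EuclideanSpace ℝ (Fin n), 0 ≤ hPB N U f c Δ hf αf x) ∧
    ∀ x : EuclideanSpace ℝ (Fin n), ∃ u : ℕ → EuclideanSpace ℝ (Fin m),
      (∀ i < N, u i ∈ U) ∧ hPB N U f c Δ hf αf x = pcbfCost N f c Δ hf αf x u := by
  have hK : IsCompact (Set.univ.pi fun _ : ℕ => U) := isCompact_univ_pi fun _ => hUcomp
  have hKne : (Set.univ.pi fun _ : ℕ => U).Nonempty := Set.univ_pi_nonempty_iff.2 fun _ => hUne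
  have hcost := continuous_pcbfCost (αf := αf) N Δ hfc hcc hfcont
  have hmin : ∀ x : EuclideanSpace ℝ (Fin n), ∃ u : ℕ → EuclideanSpace ℝ (Fin m),
      (∀ i < N, u i ∈ U) ∧ hPB N U f c Δ hf αf x = pcbfCost N f c Δ hf αf x u := by
    intro x
    obtain ⟨u, hu, h⟩ := hK.exists_sInf_image_eq hKne
      (hcost.comp (Continuous.prodMk_right x)).continuousOn
    exact ⟨u, fun i _ => hu i trivial, (hPB_eq_sInf_pi N Δ hUne x).trans h⟩
  refine ⟨?_, fun x => ?_, hmin⟩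
  · simp only [hPB_eq_sInf_pi N Δ hUne]
    exact hK.continuous_sInf hcost
  · obtain ⟨u, -, h⟩ := hmin x
    exact h ▸ pcbfCost_nonneg N Δ hαf.le x u
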